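/- The Euclidean logarithmic Sobolev inequality in entropy form: for any smooth function $f$ on $\mathbb{R}^n$ with $\int_{\mathbb{R}^n} (2\pi)^{-n/2} e^{-f}\,dx = 1$ (and sufficient decay), $\int_{\mathbb{R}^n} \big(\tfrac{1}{2}|\nabla f|^2 + f - n\big) (2\pi)^{-n/2} e^{-f}\,dx \geq 0$. -/

import Mathlib

open MeasureTheory Real

/-- A globally defined increasing function which on `[0, 1]` is the quantile function of the
standard Gaussian conditioned to `[-L, L]`. -/
lemma exists_truncated_gaussian_quantile {L : ℝ} (hL : 0 < L) :
    ∃ G G' : ℝ → ℝ, Continuous G ∧ Continuous G' ∧ (∀ t, HasDerivAt G (G' t) t) ∧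
      ∀ t ∈ Set.Icc (0 : ℝ) 1, |G t| ≤ L ∧
        G' t = (∫ s in -L..L, exp (-s ^ 2 / 2)) * exp (G t ^ 2 / 2) := by
  set c := ∫ s in -L..L, exp (-s ^ 2 / 2)
  set δ := exp (-L ^ 2 / 2)
  have hδ0 : 0 < δ := exp_pos _
  let w : ℝ → ℝ := fun s ↦ max (exp (-s ^ 2 / 2)) δ
  have hw : Continuous w := by fun_prop
  have hw0 (s) : 0 < w s := lt_max_of_lt_left (exp_pos _)
  have hw_eq {s : ℝ} (hs : |s| ≤ L) : w s = exp (-s ^ 2 / 2) := by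
    refine max_eq_left (exp_le_exp.2 ?_)
    have := sq_le_sq' (abs_le.1 hs).1 (abs_le.1 hs).2
    linarith
  let Φ : ℝ → ℝ := fun t ↦ ∫ s in -L..t, w s
  have hΦ (t) : HasDerivAt Φ (w t) t := hw.integral_hasStrictDerivAt _ t |>.hasDerivAt
  have hmono : StrictMono Φ := strictMono_of_deriv_pos fun t ↦ by
    rw [(hΦ t).deriv]; exact hw0 t
  have hmono' : Monotone fun t ↦ Φ t - δ * t := by
    have hd (t) : HasDerivAt (fun t ↦ Φ t - δ * t) (w t - δ * 1) t :=
      (hΦ t).sub ((hasDerivAt_id t).const_mul δ)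
    refine monotone_of_deriv_nonneg (fun t ↦ (hd t).differentiableAt) fun t ↦ ?_
    rw [(hd t).deriv, mul_one, sub_nonneg]
    exact le_max_right _ _
  have hΦc : Continuous Φ := continuous_iff_continuousAt.2 fun t ↦ (hΦ t).continuousAt
  have hsurj : Function.Surjective Φ := by
    refine hΦc.surjective ?_ ?_
    · refine Filter.tendsto_atTop_mono' _ ?_
        (Filter.tendsto_atTop_add_const_left _ (Φ 0) (Filter.tendsto_id.const_mul_atTop hδ0))
      filter_upwards [Filter.eventually_ge_atTop 0] with t ht
      have := hmono' ht
      simp only [id] at *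
      linarith
    · refine Filter.tendsto_atBot_mono' _ ?_
        (Filter.tendsto_atBot_add_const_left _ (Φ 0) (Filter.tendsto_id.const_mul_atBot hδ0))
      filter_upwards [Filter.eventually_le_atBot 0] with t ht
      have := hmono' ht
      simp only [id] at *
      linarith
  let e := hmono.orderIsoOfSurjective Φ hsurj
  have he (y) : Φ (e.symm y) = y := e.apply_symm_apply y
  have hes : Continuous e.symm := e.symm.continuous
  have hd (y) : HasDerivAt e.symm (w (e.symm y))⁻¹ y :=
    HasDerivAt.of_local_left_inverse hes.continuousAt (hΦ _) (hw0 _).ne' (.of_forall he)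
  refine ⟨fun t ↦ e.symm (c * t), fun t ↦ (w (e.symm (c * t)))⁻¹ * (c * 1), by fun_prop, ?_,
    fun t ↦ ?_, fun t ht ↦ ?_⟩
  · exact ((hw.comp (hes.comp (continuous_const.mul continuous_id))).inv₀
      fun t ↦ (hw0 _).ne').mul continuous_const
  · exact (hd (c * t)).comp t ((hasDerivAt_id t).const_mul c)
  · have hΦL : Φ L = c := by
      refine intervalIntegral.integral_congr fun s hs ↦ hw_eq ?_
      rw [Set.uIcc_of_le (by linarith)] at hs
      exact abs_le.2 hs
    have hΦL' : Φ (-L) = 0 := intervalIntegral.integral_same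
    have hc0 : 0 ≤ c := by
      rw [← hΦL, ← hΦL']
      exact hmono.monotone (by linarith)
    have hb : |e.symm (c * t)| ≤ L := by
      rw [abs_le, ← hmono.le_iff_le, ← hmono.le_iff_le (b := L), he, hΦL, hΦL']
      exact ⟨mul_nonneg hc0 ht.1, mul_le_of_le_one_right hc0 ht.2⟩
    refine ⟨hb, ?_⟩
    simp only [hw_eq hb, ← exp_neg, mul_one]
    rw [mul_comm]
    congr 2
    ring

/-- The monotone rearrangement, in the coordinate `a`, of the positive weight `q` on `[-r, r]` onto
the Gaussian conditioned to `[-L, L]`. -/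
lemma exists_coordinate_transport {ι : Type*} [Fintype ι] [DecidableEq ι] {L r : ℝ} (hL : 0 < L)
    (hr : 0 < r) {q : (ι → ℝ) → ℝ} (hq : Continuous q) (hq0 : ∀ x, 0 < q x) (a : ι) :
    ∃ T S : (ι → ℝ) → ℝ, Continuous T ∧ Continuous S ∧
      (∀ x, HasLineDerivAt ℝ T (S x) x (Pi.single a 1)) ∧
      ∀ x, |x a| ≤ r → |T x| ≤ L ∧
        S x = (∫ s in -L..L, exp (-s ^ 2 / 2)) * exp (T x ^ 2 / 2) *
          (q x / ∫ t in -r..r, q (Function.update x a t)) := by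
  obtain ⟨G, G', hG, hG', hd, hI⟩ := exists_truncated_gaussian_quantile hL
  have hu : Continuous (Function.uncurry fun (x : ι → ℝ) (t : ℝ) ↦ q (Function.update x a t)) :=
    hq.comp (continuous_fst.update a continuous_snd)
  have hux (x : ι → ℝ) : Continuous fun t ↦ q (Function.update x a t) :=
    hu.comp (Continuous.prodMk_right x)
  have hi (x : ι → ℝ) (b c : ℝ) :
      IntervalIntegrable (fun t ↦ q (Function.update x a t)) volume b c :=
    (hux x).intervalIntegrable _ _
  set m : (ι → ℝ) → ℝ := fun x ↦ ∫ t in -r..r, q (Function.update x a t) with hm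
  have hmc : Continuous m :=
    intervalIntegral.continuous_parametric_intervalIntegral_of_continuous' hu _ _
  have hm0 (x) : 0 < m x :=
    intervalIntegral.intervalIntegral_pos_of_pos (hi x _ _) (fun t ↦ hq0 _) (by linarith)
  let F : (ι → ℝ) → ℝ := fun x ↦ (∫ t in -r..x a, q (Function.update x a t)) / m x
  have hF : Continuous F :=
    (intervalIntegral.continuous_parametric_intervalIntegral_of_continuous hu
      (continuous_apply a)).div hmc fun x ↦ (hm0 x).ne'
  refine ⟨fun x ↦ G (F x), fun x ↦ G' (F x) * (q x / m x), hG.comp hF,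
    (hG'.comp hF).mul (hq.div hmc fun x ↦ (hm0 x).ne'), fun x ↦ ?_, fun x hx ↦ ?_⟩
  · have hline (t : ℝ) : F (x + t • Pi.single a 1) =
        (∫ s in -r..(x a + t), q (Function.update x a s)) / m x := by
      have hupd (s : ℝ) : Function.update (x + t • Pi.single a (1 : ℝ)) a s =
          Function.update x a s := by
        ext j
        by_cases hj : j = a
        · subst hj; simp
        · simp [hj]
      simp [F, hm, hupd]
    have hFd : HasLineDerivAt ℝ F (q x / m x) x (Pi.single a 1) := by
      rw [HasLineDerivAt, funext hline]
      have h1 := ((hux x).integral_hasStrictDerivAt (-r) (x a + 0)).hasDerivAt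
      have h2 := (h1.comp_const_add (x a) 0).div_const (m x)
      simpa using h2
    have := HasDerivAt.comp (x := (0 : ℝ)) (h₂ := G) (h := fun t ↦ F (x + t • Pi.single a 1))
      (h₂' := G' (F x)) (by simpa using hd (F x)) hFd
    exact this
  · have hx' := abs_le.1 hx
    have hF01 : F x ∈ Set.Icc (0 : ℝ) 1 := by
      refine ⟨div_nonneg (intervalIntegral.integral_nonneg hx'.1 fun t _ ↦ (hq0 _).le) (hm0 x).le,
        (div_le_one (hm0 x)).2 ?_⟩
      simp only [hm]
      rw [← intervalIntegral.integral_add_adjacent_intervals (hi x (-r) (x a)) (hi x (x a) r)]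
      exact le_add_of_nonneg_right
        (intervalIntegral.integral_nonneg hx'.2 fun t _ ↦ (hq0 _).le)
    refine ⟨(hI _ hF01).1, ?_⟩
    simp only [(hI _ hF01).2, hm]

/-- Iterated coordinate transports: a triangular map pushing the restriction of `p` to a box to a
truncated Gaussian, with the Jacobian equation written through the diagonal derivatives `S`. -/
lemma exists_triangular_transport {ι : Type*} [Fintype ι] [DecidableEq ι] {L r : ℝ} (hL : 0 < L)
    (hr : 0 < r) {p : (ι → ℝ) → ℝ} (hp : Continuous p) (hp0 : ∀ x, 0 < p x) (s : Finset ι) :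
    ∃ (T S : ι → (ι → ℝ) → ℝ) (q : (ι → ℝ) → ℝ),
      (∀ k, Continuous (T k)) ∧ (∀ k, Continuous (S k)) ∧ Continuous q ∧ (∀ x, 0 < q x) ∧
      (∀ x, ENNReal.ofReal (q x) ≤
        lmarginal (fun _ ↦ volume) s (fun y ↦ ENNReal.ofReal (p y)) x) ∧
      (∀ k ∈ s, ∀ x, HasLineDerivAt ℝ (T k) (S k x) x (Pi.single k 1)) ∧
      ∀ x, (∀ k, |x k| ≤ r) → (∀ k ∈ s, |T k x| ≤ L ∧ 0 < S k x) ∧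
        (∏ k ∈ s, S k x) * q x =
          (∏ k ∈ s, (∫ t in -L..L, exp (-t ^ 2 / 2)) * exp (T k x ^ 2 / 2)) * p x := by
  have hc0 : 0 < ∫ t in -L..L, exp (-t ^ 2 / 2) :=
    intervalIntegral.intervalIntegral_pos_of_pos (Continuous.intervalIntegrable (by fun_prop) _ _)
      (fun t ↦ exp_pos _) (by linarith)
  induction s using Finset.induction_on with
  | empty =>
    exact ⟨fun _ _ ↦ 0, fun _ _ ↦ 0, p, fun _ ↦ continuous_const, fun _ ↦ continuous_const, hp,
      hp0, by simp, by simp, by simp⟩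
  | insert a s ha ih =>
    obtain ⟨T, S, q, hT, hS, hq, hq0, hqp, hd, hbox⟩ := ih
    obtain ⟨Ta, Sa, hTa, hSa, hda, hboxa⟩ := exists_coordinate_transport hL hr hq hq0 a
    have hu : Continuous
        (Function.uncurry fun (x : ι → ℝ) (t : ℝ) ↦ q (Function.update x a t)) :=
      hq.comp (continuous_fst.update a continuous_snd)
    have hux (x : ι → ℝ) : Continuous fun t ↦ q (Function.update x a t) :=
      hu.comp (Continuous.prodMk_right x)
    have hm0 (x : ι → ℝ) : 0 < ∫ t in -r..r, q (Function.update x a t) :=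
      intervalIntegral.intervalIntegral_pos_of_pos ((hux x).intervalIntegrable _ _)
        (fun t ↦ hq0 _) (by linarith)
    have hne {k : ι} (hk : k ∈ s) : k ≠ a := fun h ↦ ha (h ▸ hk)
    refine ⟨Function.update T a Ta, Function.update S a Sa,
      fun x ↦ ∫ t in -r..r, q (Function.update x a t), fun k ↦ ?_, fun k ↦ ?_,
      intervalIntegral.continuous_parametric_intervalIntegral_of_continuous' hu _ _, hm0,
      fun x ↦ ?_, fun k hk ↦ ?_, fun x hx ↦ ?_⟩
    · by_cases hk : k = a
      · subst hk; simpa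
      · simpa [hk] using hT k
    · by_cases hk : k = a
      · subst hk; simpa
      · simpa [hk] using hS k
    · beta_reduce
      rw [lmarginal_insert _ (by fun_prop) ha, intervalIntegral.integral_of_le (by linarith),
        ofReal_integral_eq_lintegral_ofReal
          (((hux x).intervalIntegrable (-r) r).1) (.of_forall fun t ↦ (hq0 _).le)]
      exact (setLIntegral_le_lintegral _ _).trans (lintegral_mono fun t ↦ hqp _)
    · rcases Finset.mem_insert.1 hk with rfl | hk
      · simpa using hda
      · simpa [hne hk] using hd k hk
    · obtain ⟨hTS, hprod⟩ := hbox x hx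
      obtain ⟨hTL, hSeq⟩ := hboxa x (hx a)
      constructor
      · intro k hk
        rcases Finset.mem_insert.1 hk with rfl | hk
        · simp only [Function.update_self]
          refine ⟨hTL, hSeq ▸ ?_⟩
          have := hq0 x
          have := hm0 x
          positivity
        · simpa [hne hk] using hTS k hk
      · have hS_eq : ∏ k ∈ s, Function.update S a Sa k x = ∏ k ∈ s, S k x :=
          Finset.prod_congr rfl fun k hk ↦ by rw [Function.update_of_ne (hne hk)]
        have hT_eq : ∏ k ∈ s, (∫ t in -L..L, exp (-t ^ 2 / 2)) *
              exp (Function.update T a Ta k x ^ 2 / 2) =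
            ∏ k ∈ s, (∫ t in -L..L, exp (-t ^ 2 / 2)) * exp (T k x ^ 2 / 2) :=
          Finset.prod_congr rfl fun k hk ↦ by rw [Function.update_of_ne (hne hk)]
        rw [Finset.prod_insert ha, Finset.prod_insert ha, hS_eq, hT_eq]
        simp only [Function.update_self]
        rw [mul_assoc _ _ (p x), ← hprod, hSeq]
        have := (hm0 x).ne'
        field_simp

/-- The pointwise consequence of the Jacobian equation and `log s ≤ s - 1`. -/
lemma exists_triangular_transport_le {ι : Type*} [Fintype ι] [DecidableEq ι] {L r : ℝ}
    (hL : 0 < L) (hr : 0 < r) {v : (ι → ℝ) → ℝ} (hv : Continuous v)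
    (hint : Integrable fun x ↦ exp (-v x)) (hnorm : ∫ x, exp (-v x) = 1) :
    ∃ T S : ι → (ι → ℝ) → ℝ, (∀ k, Continuous (T k)) ∧ (∀ k, Continuous (S k)) ∧
      (∀ k x, HasLineDerivAt ℝ (T k) (S k x) x (Pi.single k 1)) ∧
      ∀ x, (∀ k, |x k| ≤ r) → (∀ k, |T k x| ≤ L) ∧
        ∑ k, (T k x ^ 2 / 2 - S k x + (log (∫ t in -L..L, exp (-t ^ 2 / 2)) + 1)) ≤ v x := by
  have hc0 : 0 < ∫ t in -L..L, exp (-t ^ 2 / 2) :=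
    intervalIntegral.intervalIntegral_pos_of_pos (Continuous.intervalIntegrable (by fun_prop) _ _)
      (fun t ↦ exp_pos _) (by linarith)
  obtain ⟨T, S, q, hT, hS, -, hq0, hqp, hd, hbox⟩ :=
    exists_triangular_transport hL hr (p := fun x ↦ exp (-v x)) (by fun_prop)
      (fun x ↦ exp_pos _) Finset.univ
  refine ⟨T, S, hT, hS, fun k ↦ hd k (Finset.mem_univ k), fun x hx ↦ ?_⟩
  obtain ⟨hTS, hprod⟩ := hbox x hx
  refine ⟨fun k ↦ (hTS k (Finset.mem_univ k)).1, ?_⟩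
  have hq1 : q x ≤ 1 := by
    have := hqp x
    rw [lmarginal_univ, ← volume_pi,
      ← ofReal_integral_eq_lintegral_ofReal hint (.of_forall fun x ↦ (exp_pos _).le), hnorm] at this
    exact (ENNReal.ofReal_le_ofReal_iff zero_le_one).1 this
  have hlog := congrArg log hprod
  have hS0 (k) : 0 < S k x := (hTS k (Finset.mem_univ k)).2
  rw [log_mul (Finset.prod_pos fun k _ ↦ hS0 k).ne' (hq0 x).ne',
    log_mul (Finset.prod_pos fun k _ ↦ mul_pos hc0 (exp_pos _)).ne' (exp_pos _).ne', log_exp,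
    log_prod fun k _ ↦ (hS0 k).ne', log_prod fun k _ ↦ (mul_pos hc0 (exp_pos _)).ne'] at hlog
  simp_rw [log_mul hc0.ne' (exp_pos _).ne', log_exp] at hlog
  have hlogS : ∑ k, log (S k x) ≤ ∑ k, (S k x - 1) :=
    Finset.sum_le_sum fun k _ ↦ log_le_sub_one_of_pos (hS0 k)
  have hlogq : log (q x) ≤ 0 := log_nonpos (hq0 x).le hq1
  simp only [Finset.sum_add_distrib, Finset.sum_sub_distrib] at *
  linarith

/-- A localized logarithmic Sobolev inequality for a cutoff `χ` supported in a box. -/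
lemma cutoff_log_sobolev {ι : Type*} [Fintype ι] [DecidableEq ι] {L r K : ℝ}
    (hL : 0 < L) (hr : 0 < r) {v χ : (ι → ℝ) → ℝ} (hv : ContDiff ℝ 1 v)
    (hint : Integrable fun x ↦ exp (-v x)) (hnorm : ∫ x, exp (-v x) = 1)
    (hχ : ContDiff ℝ 1 χ) (hχc : HasCompactSupport χ) (hχ0 : ∀ x, 0 ≤ χ x)
    (hχr : ∀ x ∈ tsupport χ, ∀ k, |x k| ≤ r)
    (hχK : ∀ x k, |fderiv ℝ χ x (Pi.single k 1)| ≤ K) :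
    -(Fintype.card ι * (L * K)) ≤ ∫ x, χ x * ((1 / 2 * ∑ k, fderiv ℝ v x (Pi.single k 1) ^ 2 + v x -
      Fintype.card ι * (log (∫ t in -L..L, exp (-t ^ 2 / 2)) + 1)) * exp (-v x)) := by
  obtain ⟨T, S, hT, hS, hd, hbox⟩ := exists_triangular_transport_le hL hr hv.continuous hint hnorm
  set g : (ι → ℝ) → ℝ := fun x ↦ χ x * exp (-v x) with hg
  have hgd : ContDiff ℝ 1 g := hχ.mul (hv.neg.exp)
  have hgc : HasCompactSupport g := hχc.mul_right
  have hg' (x) (k) : fderiv ℝ g x (Pi.single k 1) = fderiv ℝ χ x (Pi.single k 1) * exp (-v x) -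
      χ x * exp (-v x) * fderiv ℝ v x (Pi.single k 1) := by
    have h1 := (hχ.differentiable one_ne_zero x).hasFDerivAt
    have h2 := (hv.differentiable one_ne_zero x).hasFDerivAt
    have h3 : HasFDerivAt g _ x := h1.mul h2.neg.exp
    rw [h3.fderiv]
    simp
    ring
  have hgk (k) : Continuous fun x ↦ fderiv ℝ g x (Pi.single k 1) :=
    (hgd.continuous_fderiv one_ne_zero).clm_apply continuous_const
  have hgkc (k) : HasCompactSupport fun x ↦ fderiv ℝ g x (Pi.single k 1) :=
    hgc.fderiv_apply ℝ _
  have hI1 (k) : Integrable fun x ↦ T k x * fderiv ℝ g x (Pi.single k 1) :=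
    ((hT k).mul (hgk k)).integrable_of_hasCompactSupport (hgkc k).mul_left
  have hI2 (k) : Integrable fun x ↦ S k x * g x :=
    ((hS k).mul hgd.continuous).integrable_of_hasCompactSupport hgc.mul_left
  have hI3 (k) : Integrable fun x ↦ T k x * g x :=
    ((hT k).mul hgd.continuous).integrable_of_hasCompactSupport hgc.mul_left
  have hparts (k) : ∫ x, (T k x * fderiv ℝ g x (Pi.single k 1) + S k x * g x) = 0 := by
    rw [integral_add (hI1 k) (hI2 k)]
    have := integral_bilinear_hasLineDerivAt_right_eq_neg_left_of_integrable
      (B := ContinuousLinearMap.mul ℝ ℝ) (hI2 k) (hI1 k) (hI3 k) (fun x _ ↦ hd k x)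
      (fun x _ ↦ (hgd.differentiable one_ne_zero x).hasFDerivAt.hasLineDerivAt _)
    simp only [ContinuousLinearMap.mul_apply'] at this
    linarith
  have hI4 (k) : Integrable fun x ↦ -(T k x * fderiv ℝ g x (Pi.single k 1) + S k x * g x) -
      L * K * exp (-v x) := ((hI1 k).add (hI2 k)).neg.sub (hint.const_mul _)
  have hlow : ∫ x, ∑ k, (-(T k x * fderiv ℝ g x (Pi.single k 1) + S k x * g x) -
      L * K * exp (-v x)) = -(Fintype.card ι * (L * K)) := by
    rw [integral_finsetSum _ fun k _ ↦ hI4 k]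
    have (k : ι) : ∫ x, (-(T k x * fderiv ℝ g x (Pi.single k 1) + S k x * g x) -
        L * K * exp (-v x)) = -(L * K) := by
      have hI : Integrable fun x ↦ -(T k x * fderiv ℝ g x (Pi.single k 1) + S k x * g x) :=
        ((hI1 k).add (hI2 k)).neg
      rw [integral_sub hI (hint.const_mul _), integral_neg, hparts, integral_const_mul, hnorm]
      ring
    simp_rw [this]
    simp
  rw [← hlow]
  have hvk (k) : Continuous fun x ↦ fderiv ℝ v x (Pi.single k 1) :=
    (hv.continuous_fderiv one_ne_zero).clm_apply continuous_const
  refine integral_mono (integrable_finsetSum _ fun k _ ↦ hI4 k) ?_ fun x ↦ ?_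
  · have := hv.continuous
    have := hχ.continuous
    exact Continuous.integrable_of_hasCompactSupport (by fun_prop) hχc.mul_right
  · beta_reduce
    have hLK (k : ι) : 0 ≤ L * K := mul_nonneg hL.le ((abs_nonneg _).trans (hχK x k))
    by_cases hx : x ∈ tsupport χ
    · obtain ⟨hTL, hle⟩ := hbox x (hχr x hx)
      have hgx : 0 ≤ g x := mul_nonneg (hχ0 x) (exp_pos _).le
      calc _ ≤ ∑ k, g x * (1 / 2 * fderiv ℝ v x (Pi.single k 1) ^ 2 +
            (T k x ^ 2 / 2 - S k x)) := by
            refine Finset.sum_le_sum fun k _ ↦ ?_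
            have h1 : |T k x * fderiv ℝ χ x (Pi.single k 1)| ≤ L * K := by
              rw [abs_mul]
              exact mul_le_mul (hTL k) (hχK x k) (abs_nonneg _) hL.le
            have h2 := mul_le_mul_of_nonneg_right (neg_le_of_abs_le h1) (exp_pos (-v x)).le
            have h3 := mul_nonneg hgx (sq_nonneg (fderiv ℝ v x (Pi.single k 1) - T k x))
            rw [hg' x k]
            simp only [hg] at h3 ⊢
            linarith
        _ = g x * (1 / 2 * ∑ k, fderiv ℝ v x (Pi.single k 1) ^ 2 +
            (∑ k, (T k x ^ 2 / 2 - S k x + (log (∫ t in -L..L, exp (-t ^ 2 / 2)) + 1)) -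
              Fintype.card ι * (log (∫ t in -L..L, exp (-t ^ 2 / 2)) + 1))) := by
            rw [← Finset.mul_sum, Finset.sum_add_distrib, ← Finset.mul_sum,
              Finset.sum_add_distrib (f := fun k ↦ T k x ^ 2 / 2 - S k x), Finset.sum_const,
              Finset.card_univ, nsmul_eq_mul, add_sub_cancel_right]
        _ ≤ g x * (1 / 2 * ∑ k, fderiv ℝ v x (Pi.single k 1) ^ 2 +
            (v x - Fintype.card ι * (log (∫ t in -L..L, exp (-t ^ 2 / 2)) + 1))) := by
            gcongr
        _ = _ := by
            simp only [hg]
            ring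
    · have hg0 (k) : fderiv ℝ g x (Pi.single k 1) = 0 := by
        have hxg : x ∉ tsupport g := fun h ↦ hx (tsupport_mul_subset_left h)
        have := image_eq_zero_of_notMem_tsupport fun h ↦ hxg (tsupport_fderiv_subset ℝ h)
        rw [this]
        rfl
      have hχx : χ x = 0 := image_eq_zero_of_notMem_tsupport hx
      have hgx : g x = 0 := by simp [hg, hχx]
      simp only [hg0, hgx, hχx, zero_mul, mul_zero, add_zero, neg_zero, zero_sub]
      exact Finset.sum_nonpos fun k _ ↦
        neg_nonpos.2 (mul_nonneg (hLK k) (exp_pos _).le)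

/-- The logarithmic Sobolev inequality with a truncated Gaussian constant. -/
lemma truncated_log_sobolev {ι : Type*} [Fintype ι] [DecidableEq ι] {L : ℝ} (hL : 0 < L)
    {v : (ι → ℝ) → ℝ} (hv : ContDiff ℝ 1 v)
    (hint : Integrable fun x ↦ exp (-v x)) (hnorm : ∫ x, exp (-v x) = 1)
    (hint2 : Integrable fun x ↦ (1 / 2 * ∑ k, fderiv ℝ v x (Pi.single k 1) ^ 2 + v x -
      Fintype.card ι * (log (∫ t in -L..L, exp (-t ^ 2 / 2)) + 1)) * exp (-v x)) :
    0 ≤ ∫ x, (1 / 2 * ∑ k, fderiv ℝ v x (Pi.single k 1) ^ 2 + v x -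
      Fintype.card ι * (log (∫ t in -L..L, exp (-t ^ 2 / 2)) + 1)) * exp (-v x) := by
  let b : ContDiffBump (0 : ι → ℝ) := ⟨1, 2, one_pos, one_lt_two⟩
  have hb : ContDiff ℝ 1 b := b.contDiff
  obtain ⟨C, hC⟩ := (hb.continuous_fderiv one_ne_zero).bounded_above_of_compact_support
    (b.hasCompactSupport.fderiv ℝ)
  let χ : ℕ → (ι → ℝ) → ℝ := fun N x ↦ b ((N + 1 : ℝ)⁻¹ • x)
  have hN (N : ℕ) : (0 : ℝ) < N + 1 := by positivity
  have hlim : Filter.Tendsto (fun N : ℕ ↦ (N + 1 : ℝ)⁻¹) Filter.atTop (nhds 0) := by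
    simpa using tendsto_one_div_add_atTop_nhds_zero_nat (𝕜 := ℝ)
  have hχ (N) : ContDiff ℝ 1 (χ N) := hb.comp (contDiff_const_smul _)
  have hsupp (N) {x : ι → ℝ} (hx : x ∈ tsupport (χ N)) : ‖x‖ ≤ 2 * (N + 1) := by
    have h1 := tsupport_comp_subset_preimage b (continuous_const_smul ((N + 1 : ℝ)⁻¹)) hx
    rw [Set.mem_preimage, b.tsupport_eq, mem_closedBall_zero_iff, norm_smul, norm_inv,
      norm_of_nonneg (hN N).le, inv_mul_le_iff₀ (hN N)] at h1
    simpa [b, mul_comm] using h1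
  have hcut (N : ℕ) := cutoff_log_sobolev (K := C * (N + 1 : ℝ)⁻¹) hL
    (by have := hN N; positivity : (0 : ℝ) < 2 * (N + 1)) hv hint hnorm (hχ N)
    (HasCompactSupport.of_support_subset_isCompact (isCompact_closedBall 0 (2 * (N + 1 : ℝ)))
      fun x hx ↦ mem_closedBall_zero_iff.2 (hsupp N (subset_tsupport _ hx)))
    (fun x ↦ b.nonneg) (fun x hx k ↦ (norm_le_pi_norm x k).trans (hsupp N hx)) (fun x k ↦ by
      have h1 : HasFDerivAt (χ N) ((fderiv ℝ b ((N + 1 : ℝ)⁻¹ • x)).comp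
          ((N + 1 : ℝ)⁻¹ • ContinuousLinearMap.id ℝ (ι → ℝ))) x :=
        (hb.differentiable one_ne_zero _).hasFDerivAt.comp x
          ((N + 1 : ℝ)⁻¹ • ContinuousLinearMap.id ℝ (ι → ℝ)).hasFDerivAt
      rw [h1.fderiv, ← norm_eq_abs]
      refine (ContinuousLinearMap.le_opNorm _ _).trans ?_
      rw [Pi.norm_single, norm_one, mul_one]
      refine (ContinuousLinearMap.opNorm_comp_le _ _).trans ?_
      have h2 : ‖(N + 1 : ℝ)⁻¹ • ContinuousLinearMap.id ℝ (ι → ℝ)‖ ≤ (N + 1 : ℝ)⁻¹ := by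
        rw [norm_smul, norm_of_nonneg (inv_nonneg.2 (hN N).le)]
        exact mul_le_of_le_one_right (inv_nonneg.2 (hN N).le) ContinuousLinearMap.norm_id_le
      exact mul_le_mul (hC _) h2 (norm_nonneg _) ((norm_nonneg _).trans (hC 0)))
  have hleft : Filter.Tendsto (fun N : ℕ ↦ -(Fintype.card ι * (L * (C * (N + 1 : ℝ)⁻¹))))
      Filter.atTop (nhds 0) := by
    simpa using (((hlim.const_mul C).const_mul L).const_mul (Fintype.card ι : ℝ)).neg
  refine le_of_tendsto_of_tendsto' hleft (tendsto_integral_of_dominated_convergence _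
    (fun N ↦ (hχ N).continuous.aestronglyMeasurable.mul hint2.1) hint2.norm (fun N ↦ ?_) ?_) hcut
  · refine .of_forall fun x ↦ ?_
    rw [Pi.mul_apply, norm_mul]
    refine mul_le_of_le_one_left (norm_nonneg _) ?_
    rw [norm_of_nonneg b.nonneg]
    exact b.le_one
  · refine .of_forall fun x ↦ ?_
    have h1 : Filter.Tendsto (fun N : ℕ ↦ χ N x) Filter.atTop (nhds 1) := by
      have h2 : Filter.Tendsto (fun N : ℕ ↦ (N + 1 : ℝ)⁻¹ • x) Filter.atTop (nhds 0) := by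
        simpa using hlim.smul_const x
      have h3 := (hb.continuous.tendsto 0).comp h2
      rwa [b.one_of_mem_closedBall (Metric.mem_closedBall_self b.rIn_pos.le)] at h3
    simpa using h1.mul_const _

lemma tendsto_log_integral_gaussian :
    Filter.Tendsto (fun N : ℕ ↦ log (∫ t in -(N + 1 : ℝ)..(N + 1), exp (-t ^ 2 / 2)))
      Filter.atTop (nhds (log (2 * π) / 2)) := by
  have hN : Filter.Tendsto (fun N : ℕ ↦ (N + 1 : ℝ)) Filter.atTop Filter.atTop :=
    Filter.tendsto_atTop_add_const_right _ _ tendsto_natCast_atTop_atTop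
  have hfun (t : ℝ) : exp (-t ^ 2 / 2) = exp (-(1 / 2) * t ^ 2) := by ring_nf
  have hval : ∫ t : ℝ, exp (-(1 / 2) * t ^ 2) = √(2 * π) := by
    rw [integral_gaussian]
    congr 1
    ring
  simp_rw [hfun]
  rw [← log_sqrt (by positivity), ← hval]
  refine (intervalIntegral_tendsto_integral (integrable_exp_neg_mul_sq (by norm_num))
    (Filter.tendsto_neg_atTop_atBot.comp hN) hN).log ?_
  rw [hval]
  positivity

/-- The logarithmic Sobolev inequality in coordinates, for the density `exp (-v)`. -/
lemma log_sobolev_pi {ι : Type*} [Fintype ι] [DecidableEq ι]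
    {v : (ι → ℝ) → ℝ} (hv : ContDiff ℝ 1 v)
    (hint : Integrable fun x ↦ exp (-v x)) (hnorm : ∫ x, exp (-v x) = 1)
    (hint2 : Integrable fun x ↦ (1 / 2 * ∑ k, fderiv ℝ v x (Pi.single k 1) ^ 2 + v x -
      Fintype.card ι * (log (2 * π) / 2 + 1)) * exp (-v x)) :
    0 ≤ ∫ x, (1 / 2 * ∑ k, fderiv ℝ v x (Pi.single k 1) ^ 2 + v x -
      Fintype.card ι * (log (2 * π) / 2 + 1)) * exp (-v x) := by
  set A : (ι → ℝ) → ℝ := fun x ↦ (1 / 2 * ∑ k, fderiv ℝ v x (Pi.single k 1) ^ 2 + v x -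
      Fintype.card ι * (log (2 * π) / 2 + 1)) * exp (-v x) with hA
  have hsplit (a : ℝ) : (fun x ↦ (1 / 2 * ∑ k, fderiv ℝ v x (Pi.single k 1) ^ 2 + v x -
      Fintype.card ι * (a + 1)) * exp (-v x)) =
      fun x ↦ A x + Fintype.card ι * (log (2 * π) / 2 - a) * exp (-v x) := by
    funext x
    simp only [hA]
    ring
  have hlow (N : ℕ) : 0 ≤ (∫ x, A x) + Fintype.card ι * (log (2 * π) / 2 - log (∫ t in
      -(N + 1 : ℝ)..(N + 1), exp (-t ^ 2 / 2))) := by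
    have h1 := truncated_log_sobolev (L := N + 1) (by positivity) hv hint hnorm
    rw [hsplit] at h1
    have h2 := h1 (hint2.add (hint.const_mul _))
    rw [integral_add hint2 (hint.const_mul _), integral_const_mul, hnorm, mul_one] at h2
    exact h2
  have hlim := ((tendsto_log_integral_gaussian.const_sub (log (2 * π) / 2)).const_mul
    (Fintype.card ι : ℝ)).const_add (∫ x, A x)
  simp only [sub_self, mul_zero, add_zero] at hlim
  exact ge_of_tendsto' hlim hlow

/-- The Euclidean logarithmic Sobolev inequality in entropy form (Gross; Ni (0.8)):
for any smooth `f : ℝⁿ → ℝ` with `∫ (2π)^{-n/2} e^{-f} dx = 1` and the relevant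
integrals finite, `∫ (½|∇f|² + f - n)(2π)^{-n/2} e^{-f} dx ≥ 0`. -/
theorem euclidean_log_sobolev_entropy_form (n : ℕ)
    (f : EuclideanSpace ℝ (Fin n) → ℝ) (hf : ContDiff ℝ (⊤ : ℕ∞) f)
    (hint : Integrable
      (fun x => (2 * Real.pi) ^ (-(n : ℝ) / 2) * Real.exp (-(f x))))
    (hint2 : Integrable (fun x =>
      (1 / 2 * ‖gradient f x‖ ^ 2 + f x - n)
        * ((2 * Real.pi) ^ (-(n : ℝ) / 2) * Real.exp (-(f x)))))
    (hnorm : ∫ x, (2 * Real.pi) ^ (-(n : ℝ) / 2) * Real.exp (-(f x)) = 1) :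
    0 ≤ ∫ x, (1 / 2 * ‖gradient f x‖ ^ 2 + f x - n)
        * ((2 * Real.pi) ^ (-(n : ℝ) / 2) * Real.exp (-(f x))) := by
  have hmp := PiLp.volume_preserving_toLp (Fin n)
  have hemb := (MeasurableEquiv.toLp 2 (Fin n → ℝ)).measurableEmbedding
  let Λ := (PiLp.continuousLinearEquiv 2 ℝ (fun _ : Fin n ↦ ℝ)).symm
  let v : (Fin n → ℝ) → ℝ := fun x ↦ f (Λ x) + n * (log (2 * π) / 2)
  have hv : ContDiff ℝ 1 v :=
    ((hf.of_le (by exact_mod_cast le_top)).comp Λ.contDiff).add contDiff_const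
  have hexp (x) : (2 * π) ^ (-(n : ℝ) / 2) * exp (-f (Λ x)) = exp (-v x) := by
    rw [rpow_def_of_pos (by positivity), ← exp_add]
    congr 1
    simp only [v]
    ring
  have hgrad (x) : ‖gradient f (Λ x)‖ ^ 2 = ∑ k, fderiv ℝ v x (Pi.single k 1) ^ 2 := by
    have hd : HasFDerivAt v ((fderiv ℝ f (Λ x)).comp (Λ : (Fin n → ℝ) →L[ℝ] _)) x :=
      (((hf.differentiable (by simp)) (Λ x)).hasFDerivAt.comp x Λ.hasFDerivAt).add_const _
    rw [EuclideanSpace.real_norm_sq_eq]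
    refine Finset.sum_congr rfl fun k _ ↦ ?_
    have hsingle : Λ (Pi.single k 1) = EuclideanSpace.single k (1 : ℝ) := rfl
    rw [hd.fderiv, ContinuousLinearMap.comp_apply, ContinuousLinearEquiv.coe_coe, hsingle,
      ← inner_gradient_left, EuclideanSpace.inner_single_right]
    simp
  have hfun (x) : (1 / 2 * ‖gradient f (Λ x)‖ ^ 2 + f (Λ x) - n)
        * ((2 * π) ^ (-(n : ℝ) / 2) * exp (-(f (Λ x)))) =
      (1 / 2 * ∑ k, fderiv ℝ v x (Pi.single k 1) ^ 2 + v x -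
        Fintype.card (Fin n) * (log (2 * π) / 2 + 1)) * exp (-v x) := by
    rw [hexp, hgrad, Fintype.card_fin]
    simp only [v]
    ring
  rw [← hmp.integrable_comp_emb hemb] at hint hint2
  rw [← hmp.integral_comp hemb] at hnorm ⊢
  have hint' : Integrable fun x ↦ exp (-v x) := by
    simp only [← hexp]; exact hint
  have hint2' : Integrable fun x ↦ (1 / 2 * ∑ k, fderiv ℝ v x (Pi.single k 1) ^ 2 + v x -
      Fintype.card (Fin n) * (log (2 * π) / 2 + 1)) * exp (-v x) := by
    simp only [← hfun]; exact hint2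
  have := log_sobolev_pi hv hint' (by simp only [← hexp]; exact hnorm) hint2'
  simp only [← hfun] at this
  exact this
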